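/- Let k be a field of characteristic zero and let X = V(q) ⊂ ℙⁿ_k be a smooth quadric hypersurface with a k-rational point, written (after a linear change of coordinates) as q(x₀,…,xₙ) = x₀x₁ + q'(x₂,…,xₙ) with q' a quadratic form, and let Y := V(q') ⊂ ℙ^{n−2}_k. Then [X] = 1 + 𝕃·[Y] + 𝕃^{n−1} in K₀(Var_k). -/

import Mathlib

open AlgebraicGeometry CategoryTheory CategoryTheory.Limits MvPolynomial

universe u v

noncomputable section

attribute [local instance] MvPolynomial.gradedAlgebra

/-- The base scheme `Spec k`. -/
abbrev SpecBase (k : Type u) [Field k] : Scheme.{u} := Spec (CommRingCat.of k)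

/-- The affine line `𝔸¹_k` as a scheme over `k`. -/
def AffineLine (k : Type u) [Field k] : Scheme.{u} := Spec (CommRingCat.of (Polynomial k))

/-- The structure morphism of `𝔸¹_k`. -/
def AffineLine.toSpec (k : Type u) [Field k] : AffineLine k ⟶ SpecBase k :=
  Spec.map (CommRingCat.ofHom (algebraMap k (Polynomial k)))

/-- Projective `n`-space `ℙⁿ_k = Proj k[x₀, …, xₙ]` over `k`. -/
def ProjSpace (k : Type u) [Field k] (n : ℕ) : Scheme.{u} :=
  Proj (homogeneousSubmodule (Fin (n + 1)) k)

/-- The structure morphism of `ℙⁿ_k`. -/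
def ProjSpace.toSpec (k : Type u) [Field k] (n : ℕ) : ProjSpace k n ⟶ SpecBase k :=
  Proj.toSpecZero _ ≫ Spec.map (CommRingCat.ofHom (algebraMap k _))

/-- `X` (a scheme over `k` via `sX : X ⟶ Spec k`) is the reduced closed subvariety of `ℙⁿ_k`
cut out by the family `S` of polynomials, i.e. `X → ℙⁿ_k` is a closed immersion of the reduced
scheme `X` onto the zero locus of `S`, compatibly with the structure morphisms. -/
def IsProjSubvariety (k : Type u) [Field k] (n : ℕ) (S : Set (MvPolynomial (Fin (n + 1)) k))
    (X : Scheme.{u}) (sX : X ⟶ SpecBase k) : Prop :=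
  IsReduced X ∧ ∃ i : X ⟶ ProjSpace k n, IsClosedImmersion i ∧ i ≫ ProjSpace.toSpec k n = sX ∧
    Set.range i.base = ProjectiveSpectrum.zeroLocus (homogeneousSubmodule (Fin (n + 1)) k) S

/-- `X` has a `k`-rational point, i.e. the structure morphism has a section. -/
def HasRatPoint (k : Type u) [Field k] (X : Scheme.{u}) (sX : X ⟶ SpecBase k) : Prop :=
  ∃ p : SpecBase k ⟶ X, p ≫ sX = 𝟙 (SpecBase k)

/-- A motivic measure on varieties over `k` with values in a commutative ring `R`: an
assignment, to every scheme over `k`, of an element of `R` which, on separated schemes of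
finite type over `k` (i.e. on the category `Var_k`, reducedness being irrelevant), is
invariant under isomorphisms over `k`, satisfies the scissor relations
`[X] = [X ∖ Z] + [Z]` for closed subschemes `Z ⊆ X`, is multiplicative on fibre products
over `k`, and sends `Spec k` to `1`.  These are exactly the defining relations of the
Grothendieck ring of varieties `K₀(Var_k)`, so an identity holds in `K₀(Var_k)` if and
only if it holds for every motivic measure. -/
structure MotivicMeasure (k : Type u) [Field k] (R : Type v) [CommRing R] where
  cl : ∀ (X : Scheme.{u}), (X ⟶ SpecBase k) → R
  cl_point : cl (SpecBase k) (𝟙 (SpecBase k)) = 1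
  cl_iso : ∀ {X Y : Scheme.{u}} (sX : X ⟶ SpecBase k) (sY : Y ⟶ SpecBase k) (e : X ≅ Y),
    LocallyOfFiniteType sX → QuasiCompact sX → IsSeparated sX →
    e.hom ≫ sY = sX → cl X sX = cl Y sY
  cl_scissor : ∀ {X Z : Scheme.{u}} (sX : X ⟶ SpecBase k) (i : Z ⟶ X),
    LocallyOfFiniteType sX → QuasiCompact sX → IsSeparated sX →
    IsClosedImmersion i → ∀ U : X.Opens, (U : Set X) = (Set.range i.base)ᶜ →
    cl X sX = cl U.toScheme (U.ι ≫ sX) + cl Z (i ≫ sX)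
  cl_prod : ∀ {X Y : Scheme.{u}} (sX : X ⟶ SpecBase k) (sY : Y ⟶ SpecBase k),
    LocallyOfFiniteType sX → QuasiCompact sX → IsSeparated sX →
    LocallyOfFiniteType sY → QuasiCompact sY → IsSeparated sY →
    cl (pullback sX sY) (pullback.fst sX sY ≫ sX) = cl X sX * cl Y sY

/-- The class of the affine line, `𝕃 = [𝔸¹_k]`, under a motivic measure. -/
def MotivicMeasure.lef {k : Type u} [Field k] {R : Type v} [CommRing R]
    (μ : MotivicMeasure k R) : R :=
  μ.cl (AffineLine k) (AffineLine.toSpec k)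

/-- `X` and `Y` are birational over `k`: they contain isomorphic dense open subschemes. -/
def BirationalOver (k : Type u) [Field k] (X Y : Scheme.{u})
    (sX : X ⟶ SpecBase k) (sY : Y ⟶ SpecBase k) : Prop :=
  ∃ (U : X.Opens) (V : Y.Opens) (e : U.toScheme ≅ V.toScheme),
    Dense (U : Set X) ∧ Dense (V : Set Y) ∧ e.hom ≫ V.ι ≫ sY = U.ι ≫ sX

end

noncomputable section

attribute [local instance] MvPolynomial.gradedAlgebra

namespace MotivicMeasure

variable {k : Type u} [Field k] {R : Type v} [CommRing R] (μ : MotivicMeasure k R)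

theorem cl_bot {X : Scheme.{u}} (sX : X ⟶ SpecBase k)
    [LocallyOfFiniteType sX] [QuasiCompact sX] [IsSeparated sX] :
    μ.cl (⊥ : X.Opens).toScheme ((⊥ : X.Opens).ι ≫ sX) = 0 := by
  have h := μ.cl_scissor sX (𝟙 X) ‹_› ‹_› ‹_› inferInstance ⊥ (by simp)
  simpa using h

theorem cl_eq_of_surjective {X Z : Scheme.{u}} (sX : X ⟶ SpecBase k) (i : Z ⟶ X)
    [LocallyOfFiniteType sX] [QuasiCompact sX] [IsSeparated sX] [IsClosedImmersion i]
    (hi : Function.Surjective i) : μ.cl X sX = μ.cl Z (i ≫ sX) := by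
  have h := μ.cl_scissor sX i ‹_› ‹_› ‹_› inferInstance ⊥ (by simp [hi.range_eq])
  rwa [cl_bot, zero_add] at h

theorem cl_of_isEmpty {X : Scheme.{u}} [IsEmpty X] (sX : X ⟶ SpecBase k)
    [LocallyOfFiniteType sX] [QuasiCompact sX] [IsSeparated sX] : μ.cl X sX = 0 := by
  rw [μ.cl_eq_of_surjective sX (⊥ : X.Opens).ι (fun x ↦ isEmptyElim x), cl_bot]

/-- The class of a locally closed subscheme only depends on its underlying set. -/
theorem cl_eq_of_range_eq {P Z Z' : Scheme.{u}} (sP : P ⟶ SpecBase k) (f : Z ⟶ P) (g : Z' ⟶ P)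
    [IsImmersion f] [IsImmersion g] (h : Set.range f = Set.range g)
    [LocallyOfFiniteType (f ≫ sP)] [QuasiCompact (f ≫ sP)] [IsSeparated (f ≫ sP)]
    [LocallyOfFiniteType (g ≫ sP)] [QuasiCompact (g ≫ sP)] [IsSeparated (g ≫ sP)] :
    μ.cl Z (f ≫ sP) = μ.cl Z' (g ≫ sP) := by
  have h1 : Set.range (pullback.fst f g) = Set.univ := by
    rw [Scheme.Pullback.range_fst, ← h, ← Set.image_univ, Set.preimage_image_eq _ f.injective]
  have h2 : Set.range (pullback.snd f g) = Set.univ := by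
    rw [Scheme.Pullback.range_snd, h, ← Set.image_univ, Set.preimage_image_eq _ g.injective]
  have c1 : IsClosedImmersion (pullback.fst f g) := .of_isPreimmersion _ (by simp [h1])
  have c2 : IsClosedImmersion (pullback.snd f g) := .of_isPreimmersion _ (by simp [h2])
  rw [μ.cl_eq_of_surjective _ (pullback.fst f g) (Set.range_eq_univ.mp h1),
    μ.cl_eq_of_surjective _ (pullback.snd f g) (Set.range_eq_univ.mp h2),
    pullback.condition_assoc]

/-- The class of the affine scheme of a `k`-algebra. -/
def clSpec (B : Type u) [CommRing B] [Algebra k B] : R :=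
  μ.cl (Spec (.of B)) (Spec.map (CommRingCat.ofHom (algebraMap k B)))

instance locallyOfFiniteType_specMap (B : Type u) [CommRing B] [Algebra k B]
    [Algebra.FiniteType k B] :
    LocallyOfFiniteType (Spec.map (CommRingCat.ofHom (algebraMap k B))) := by
  rw [HasRingHomProperty.Spec_iff (P := @LocallyOfFiniteType), CommRingCat.hom_ofHom,
    RingHom.finiteType_algebraMap]
  infer_instance

theorem clSpec_congr {B C : Type u} [CommRing B] [Algebra k B] [CommRing C] [Algebra k C]
    [Algebra.FiniteType k B] (e : B ≃ₐ[k] C) : μ.clSpec B = μ.clSpec C := by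
  refine μ.cl_iso _ _ (Scheme.Spec.mapIso e.symm.toRingEquiv.toCommRingCatIso.op)
    inferInstance inferInstance inferInstance ?_
  simp only [Functor.mapIso_hom, Iso.op_hom, Scheme.Spec_map, Quiver.Hom.unop_op, ← Spec.map_comp]
  congr 1
  ext x
  simp

theorem clSpec_self : μ.clSpec k = 1 := by
  rw [← μ.cl_point, clSpec]
  congr 1
  exact Spec.map_id _

theorem clSpec_polynomial (B : Type u) [CommRing B] [Algebra k B] [Algebra.FiniteType k B] :
    μ.clSpec (Polynomial B) = μ.lef * μ.clSpec B := by
  let e := (polyEquivTensor k B).trans (Algebra.TensorProduct.comm k B (Polynomial k))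
  have : Algebra.FiniteType k (TensorProduct k (Polynomial k) B) := .equiv inferInstance e
  rw [μ.clSpec_congr e]
  have h := μ.cl_prod (Spec.map (CommRingCat.ofHom (algebraMap k (Polynomial k))))
    (Spec.map (CommRingCat.ofHom (algebraMap k B)))
    inferInstance inferInstance inferInstance inferInstance inferInstance inferInstance
  refine Eq.trans ?_ h
  refine μ.cl_iso _ _ (pullbackSpecIso k (Polynomial k) B).symm
    inferInstance inferInstance inferInstance ?_
  rw [Iso.symm_hom, pullbackSpecIso_inv_fst_assoc, ← Spec.map_comp]
  rfl

theorem clSpec_mvPolynomial (n : ℕ) : μ.clSpec (MvPolynomial (Fin n) k) = μ.lef ^ n := by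
  induction n with
  | zero => rw [μ.clSpec_congr (isEmptyAlgEquiv k (Fin 0)), clSpec_self, pow_zero]
  | succ n ih => rw [μ.clSpec_congr (finSuccEquiv k n), clSpec_polynomial, ih, pow_succ']

end MotivicMeasure

theorem MvPolynomial.eval₂_mul_pow_of_isHomogeneous {σ A B : Type*} [CommSemiring A]
    [CommSemiring B] {p : MvPolynomial σ A} {d : ℕ} (hp : p.IsHomogeneous d) (f : A →+* B)
    (g : σ → B) (a : B) :
    eval₂ f g p * a ^ d = eval₂ f (fun i ↦ a * g i) p := by
  rw [MvPolynomial.eval₂_eq, MvPolynomial.eval₂_eq, Finset.sum_mul]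
  refine Finset.sum_congr rfl fun m hm ↦ ?_
  have hd := hp (mem_support_iff.mp hm)
  rw [Finsupp.weight_apply, Finsupp.sum] at hd
  simp only [smul_eq_mul, Pi.one_apply, mul_one] at hd
  simp only [mul_pow, Finset.prod_mul_distrib, Finset.prod_pow_eq_pow_sum, hd]
  ring

namespace ProjSpace

variable {k : Type u} [Field k] {n : ℕ}

theorem X_mem (j : Fin (n + 1)) :
    (X j : MvPolynomial _ k) ∈ homogeneousSubmodule (Fin (n + 1)) k 1 :=
  isHomogeneous_X k j

/-- The ring of functions on the standard chart `x_j ≠ 0`. -/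
abbrev ChartRing (k : Type u) [Field k] (j : Fin (n + 1)) : Type u :=
  HomogeneousLocalization.Away (homogeneousSubmodule (Fin (n + 1)) k) (X j)

/-- The dehomogenization map `x_i ↦ x_i / x_j`. -/
def dehomog (j : Fin (n + 1)) : MvPolynomial (Fin (n + 1)) k →+* ChartRing k j :=
  eval₂Hom ((HomogeneousLocalization.fromZeroRingHom _ _).comp
      (algebraMap k (homogeneousSubmodule (Fin (n + 1)) k 0)))
    (fun i ↦ HomogeneousLocalization.Away.mk _ (X_mem j) 1 (X i) (by simpa using X_mem i))

theorem dehomog_eq_mk (j : Fin (n + 1)) {s : MvPolynomial (Fin (n + 1)) k} {d : ℕ}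
    (hs : s ∈ homogeneousSubmodule (Fin (n + 1)) k (d • 1)) :
    dehomog j s = HomogeneousLocalization.Away.mk _ (X_mem j) d s hs := by
  apply HomogeneousLocalization.val_injective
  have hs' : s.IsHomogeneous d := by simpa using hs
  rw [HomogeneousLocalization.Away.val_mk, Localization.mk_eq_mk', eq_comm,
    IsLocalization.mk'_eq_iff_eq_mul, map_pow, ← HomogeneousLocalization.algebraMap_apply, dehomog,
    coe_eval₂Hom, hom_eval₂, eval₂_mul_pow_of_isHomogeneous hs']
  conv_lhs => rw [← eval₂_eta s, hom_eval₂]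
  congr 1
  ext i
  simp only [HomogeneousLocalization.algebraMap_apply,
    HomogeneousLocalization.Away.val_mk, Localization.mk_eq_mk']
  rw [IsLocalization.mul_mk'_eq_mk'_of_mul, eq_comm, IsLocalization.mk'_eq_iff_eq_mul]
  simp [mul_comm]

theorem dehomog_surjective (j : Fin (n + 1)) :
    Function.Surjective (dehomog j : MvPolynomial _ k →+* _) := by
  intro z
  obtain ⟨d, a, ha, rfl⟩ := HomogeneousLocalization.Away.mk_surjective _ (X_mem j) z
  exact ⟨a, dehomog_eq_mk j ha⟩

theorem dehomog_X_self (j : Fin (n + 1)) : dehomog j (X j : MvPolynomial _ k) = 1 := by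
  rw [dehomog_eq_mk j (d := 1) (by simpa using X_mem j)]
  apply HomogeneousLocalization.val_injective
  simp

/-- The coordinate ring of the part `x_j ≠ 0` of the zero locus of `S`. -/
abbrev StratumRing (S : Set (MvPolynomial (Fin (n + 1)) k)) (j : Fin (n + 1)) : Type u :=
  MvPolynomial (Fin (n + 1)) k ⧸ Ideal.span (insert (X j - 1) S)

variable (S : Set (MvPolynomial (Fin (n + 1)) k)) (j : Fin (n + 1))

theorem mk_X_stratumRing :
    Ideal.Quotient.mk (Ideal.span (insert (X j - 1) S)) (X j) = 1 := by
  rw [← sub_eq_zero, ← map_one (Ideal.Quotient.mk _), ← map_sub, Ideal.Quotient.eq_zero_iff_mem]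
  exact Ideal.subset_span (Set.mem_insert _ _)

/-- The restriction map from the chart `x_j ≠ 0` to the zero locus of `S`. -/
def chartToStratum : ChartRing k j →+* StratumRing S j :=
  (Localization.awayLift (Ideal.Quotient.mk (Ideal.span (insert (X j - 1) S))) (X j)
    (by rw [mk_X_stratumRing]; exact isUnit_one)).comp
    (algebraMap (ChartRing k j) (Localization.Away (X j)))

theorem chartToStratum_mk {d : ℕ} {s : MvPolynomial (Fin (n + 1)) k}
    (hs : s ∈ homogeneousSubmodule (Fin (n + 1)) k (d • 1)) :
    chartToStratum S j (HomogeneousLocalization.Away.mk _ (X_mem j) d s hs) =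
      Ideal.Quotient.mk _ s := by
  simp only [chartToStratum, RingHom.comp_apply, HomogeneousLocalization.algebraMap_apply,
    HomogeneousLocalization.Away.val_mk, Localization.mk_eq_mk', Localization.awayLift,
    IsLocalization.Away.lift, IsLocalization.lift_mk'_spec]
  simp [mk_X_stratumRing]

theorem chartToStratum_fromZero (c : k) :
    chartToStratum S j (HomogeneousLocalization.fromZeroRingHom _ _
      (algebraMap k (homogeneousSubmodule (Fin (n + 1)) k 0) c)) =
      algebraMap k (StratumRing S j) c := by
  simp only [chartToStratum, RingHom.comp_apply, HomogeneousLocalization.algebraMap_apply]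
  refine (IsLocalization.Away.lift_eq (X j) _ _).trans ?_
  rfl

theorem chartToStratum_comp_dehomog :
    (chartToStratum S j).comp (dehomog j) = Ideal.Quotient.mk _ := by
  apply MvPolynomial.ringHom_ext
  · intro c
    rw [RingHom.comp_apply, dehomog, coe_eval₂Hom, eval₂_C]
    exact chartToStratum_fromZero S j c
  · intro i
    rw [RingHom.comp_apply, dehomog, coe_eval₂Hom, eval₂_X, chartToStratum_mk]

theorem chartToStratum_surjective : Function.Surjective (chartToStratum S j) := by
  refine .of_comp (g := dehomog j) ?_
  rw [← RingHom.coe_comp, chartToStratum_comp_dehomog]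
  exact Ideal.Quotient.mk_surjective

theorem ker_chartToStratum :
    RingHom.ker (chartToStratum S j) = Ideal.span (dehomog j '' S) := by
  have h : RingHom.ker ((chartToStratum S j).comp (dehomog j)) =
      Ideal.span (insert (X j - 1) S) := by
    rw [chartToStratum_comp_dehomog, Ideal.mk_ker]
  rw [← RingHom.comap_ker] at h
  rw [← Ideal.map_comap_of_surjective _ (dehomog_surjective j) (RingHom.ker _), h, Ideal.map_span,
    Set.image_insert_eq, map_sub, dehomog_X_self, map_one, sub_self, Ideal.span_insert_zero]

/-- The zero locus of `S` in projective space. -/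
def locus (S : Set (MvPolynomial (Fin (n + 1)) k)) : Set (ProjSpace k n) :=
  ProjectiveSpectrum.zeroLocus (homogeneousSubmodule (Fin (n + 1)) k) S

/-- The chart `x_j ≠ 0` of projective space. -/
def chart (k : Type u) [Field k] (j : Fin (n + 1)) : (ProjSpace k n).Opens :=
  Proj.basicOpen (homogeneousSubmodule (Fin (n + 1)) k) (X j)

/-- The inclusion of the chart `x_j ≠ 0`. -/
def chartι (k : Type u) [Field k] (j : Fin (n + 1)) : Spec (.of (ChartRing k j)) ⟶ ProjSpace k n :=
  Proj.awayι _ _ (X_mem j) one_pos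

instance : IsOpenImmersion (chartι k j) := inferInstanceAs (IsOpenImmersion (Proj.awayι _ _ _ _))

/-- The inclusion of the part `x_j ≠ 0` of the zero locus of `S`. -/
def stratumι : Spec (.of (StratumRing S j)) ⟶ ProjSpace k n :=
  Spec.map (CommRingCat.ofHom (chartToStratum S j)) ≫ chartι k j

instance : IsImmersion (stratumι S j) := by
  have : IsClosedImmersion (Spec.map (CommRingCat.ofHom (chartToStratum S j))) :=
    .spec_of_surjective _ (chartToStratum_surjective S j)
  delta stratumι
  infer_instance

theorem chartι_toSpec : chartι k j ≫ ProjSpace.toSpec k n =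
    Spec.map (CommRingCat.ofHom ((HomogeneousLocalization.fromZeroRingHom _ _).comp
      (algebraMap k (homogeneousSubmodule (Fin (n + 1)) k 0)))) := by
  refine (Proj.awayι_toSpecZero_assoc _ _ (X_mem j) one_pos _).trans ?_
  rw [← Spec.map_comp]
  rfl

theorem stratumι_toSpec : stratumι S j ≫ ProjSpace.toSpec k n =
    Spec.map (CommRingCat.ofHom (algebraMap k (StratumRing S j))) := by
  rw [stratumι, Category.assoc, chartι_toSpec, ← Spec.map_comp]
  congr 1
  ext c
  exact chartToStratum_fromZero S j c

theorem chartι_mem_locus {S : Set (MvPolynomial (Fin (n + 1)) k)}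
    (hS : ∀ s ∈ S, ∃ d, 0 < d ∧ s.IsHomogeneous d)
    (p : Spec (.of (ChartRing k j))) :
    chartι k j p ∈ locus S ↔ dehomog j '' S ⊆ p.asIdeal := by
  rw [Set.image_subset_iff]
  refine forall₂_congr fun s hs ↦ ?_
  obtain ⟨d, hd, hsd⟩ := hS s hs
  have h := congrArg (p ∈ ·) (Proj.awayι_preimage_basicOpen
    (𝒜 := homogeneousSubmodule (Fin (n + 1)) k) (X_mem j) one_pos (g := s) (m' := d) hsd hd)
  have e : HomogeneousLocalization.Away.isLocalizationElem (X_mem j)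
    (𝒜 := homogeneousSubmodule (Fin (n + 1)) k) (g := s) (e := d) hsd = dehomog j s := by
    rw [dehomog_eq_mk j (d := d) (by simpa using hsd)]
    apply HomogeneousLocalization.val_injective
    simp
  rw [e] at h
  exact not_iff_not.mp (iff_of_eq h)

theorem range_stratumι {S : Set (MvPolynomial (Fin (n + 1)) k)}
    (hS : ∀ s ∈ S, ∃ d, 0 < d ∧ s.IsHomogeneous d) :
    Set.range (stratumι S j) = locus S ∩ chart k j := by
  have h1 : Set.range (Spec.map (CommRingCat.ofHom (chartToStratum S j))) =
      PrimeSpectrum.zeroLocus (dehomog j '' S) := by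
    refine (range_comap_of_surjective _ _ (chartToStratum_surjective S j)).trans ?_
    rw [ker_chartToStratum, PrimeSpectrum.zeroLocus_span]
  have h2 : Set.range (chartι k j) = chart k j :=
    congrArg (fun U : (ProjSpace k n).Opens ↦ (U : Set (ProjSpace k n)))
      (Proj.opensRange_awayι _ _ (X_mem j) one_pos)
  rw [← h2]
  ext x
  constructor
  · rintro ⟨p, rfl⟩
    exact ⟨(chartι_mem_locus j hS _).mpr (h1.subset ⟨p, rfl⟩), ⟨_, rfl⟩⟩
  · rintro ⟨hx, p, rfl⟩
    obtain ⟨y, rfl⟩ := h1.superset ((chartι_mem_locus j hS p).mp hx)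
    exact ⟨y, rfl⟩

end ProjSpace

namespace ProjSpace

variable {k : Type u} [Field k] {n : ℕ}

theorem finiteType_algebraMap_zero (k : Type u) [Field k] (n : ℕ) :
    (algebraMap k (homogeneousSubmodule (Fin (n + 1)) k 0)).FiniteType := by
  apply RingHom.FiniteType.of_surjective
  rintro ⟨p, hp⟩
  refine ⟨p.coeff 0, Subtype.ext ?_⟩
  exact (totalDegree_eq_zero_iff_eq_C.mp
    (Nat.le_zero.mp (hp : p.IsHomogeneous 0).totalDegree_le)).symm

instance : Algebra.FiniteType (homogeneousSubmodule (Fin (n + 1)) k 0)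
    (MvPolynomial (Fin (n + 1)) k) :=
  have : IsScalarTower k (homogeneousSubmodule (Fin (n + 1)) k 0) (MvPolynomial (Fin (n + 1)) k) :=
    ⟨fun a b c ↦ smul_mul_assoc a (b : MvPolynomial (Fin (n + 1)) k) c⟩
  .of_restrictScalars_finiteType k _ _

instance : LocallyOfFiniteType (toSpec k n) := by
  have : LocallyOfFiniteType (Spec.map (CommRingCat.ofHom
      (algebraMap k (homogeneousSubmodule (Fin (n + 1)) k 0)))) := by
    rw [HasRingHomProperty.Spec_iff (P := @LocallyOfFiniteType)]
    exact finiteType_algebraMap_zero k n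
  exact inferInstanceAs (LocallyOfFiniteType
    (Proj.toSpecZero (homogeneousSubmodule (Fin (n + 1)) k) ≫
      Spec.map (CommRingCat.ofHom (algebraMap k (homogeneousSubmodule (Fin (n + 1)) k 0)))))

instance : QuasiCompact (toSpec k n) :=
  inferInstanceAs (QuasiCompact (Proj.toSpecZero (homogeneousSubmodule (Fin (n + 1)) k) ≫
    Spec.map (CommRingCat.ofHom (algebraMap k (homogeneousSubmodule (Fin (n + 1)) k 0)))))

instance : IsSeparated (toSpec k n) :=
  inferInstanceAs (IsSeparated (Proj.toSpecZero (homogeneousSubmodule (Fin (n + 1)) k) ≫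
    Spec.map (CommRingCat.ofHom (algebraMap k (homogeneousSubmodule (Fin (n + 1)) k 0)))))

/-- The zero locus of `S`, as a closed subset of projective space. -/
def closedLocus (S : Set (MvPolynomial (Fin (n + 1)) k)) :
    TopologicalSpace.Closeds (ProjSpace k n) :=
  ⟨locus S, ProjectiveSpectrum.isClosed_zeroLocus _ S⟩

/-- The inclusion of the zero locus of `S`, with its reduced structure. -/
def locusι (S : Set (MvPolynomial (Fin (n + 1)) k)) :
    (Scheme.IdealSheafData.vanishingIdeal (closedLocus S)).subscheme ⟶ ProjSpace k n :=
  (Scheme.IdealSheafData.vanishingIdeal (closedLocus S)).subschemeι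

instance (S : Set (MvPolynomial (Fin (n + 1)) k)) : IsClosedImmersion (locusι S) := by
  delta locusι
  infer_instance

theorem range_locusι (S : Set (MvPolynomial (Fin (n + 1)) k)) : Set.range (locusι S) = locus S := by
  rw [locusι, Scheme.IdealSheafData.range_subschemeι]
  rfl

end ProjSpace

namespace MotivicMeasure

open ProjSpace

variable {k : Type u} [Field k] {R : Type v} [CommRing R] (μ : MotivicMeasure k R) {n : ℕ}

/-- The class of the zero locus of `S` in projective space. -/
def clLocus (S : Set (MvPolynomial (Fin (n + 1)) k)) : R :=
  μ.cl _ (locusι S ≫ toSpec k n)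

theorem cl_eq_clLocus {S : Set (MvPolynomial (Fin (n + 1)) k)} {X : Scheme.{u}}
    {sX : X ⟶ SpecBase k} (h : IsProjSubvariety k n S X sX) : μ.cl X sX = μ.clLocus S := by
  obtain ⟨-, i, hi, rfl, hr⟩ := h
  exact μ.cl_eq_of_range_eq _ _ _ (hr.trans (range_locusι S).symm)

theorem clLocus_eq_of_span_eq {S T : Set (MvPolynomial (Fin (n + 1)) k)}
    (h : Ideal.span S = Ideal.span T) : μ.clLocus S = μ.clLocus T := by
  refine μ.cl_eq_of_range_eq _ _ _ ?_
  rw [range_locusι, range_locusι, locus, ← ProjectiveSpectrum.zeroLocus_span, h,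
    ProjectiveSpectrum.zeroLocus_span, locus]

/-- Cutting the zero locus of `S` by the hyperplane `x_j = 0`. -/
theorem clLocus_eq_add {S : Set (MvPolynomial (Fin (n + 1)) k)}
    (hS : ∀ s ∈ S, ∃ d, 0 < d ∧ s.IsHomogeneous d) (j : Fin (n + 1)) :
    μ.clLocus S = μ.clSpec (StratumRing S j) + μ.clLocus (insert (X j) S) := by
  have hD : IsAffineOpen (chart k j) := Proj.isAffineOpen_basicOpen _ _ (X_mem j) one_pos
  have hz : locus (insert (X j) S) = locus S ∩ (chart k j : Set (ProjSpace k n))ᶜ := by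
    ext x
    rw [Set.mem_inter_iff, Set.mem_compl_iff, and_comm]
    refine Set.insert_subset_iff.trans (and_congr_left' ?_)
    exact not_not.symm
  let U := locusι S ⁻¹ᵁ chart k j
  have hU : IsAffineOpen U := hD.preimage (locusι S)
  have : IsAffine U.toScheme := hU
  have hle : Set.range (locusι (insert (X j) S)) ⊆ Set.range (locusι S) := by
    rw [range_locusι, range_locusι, hz]
    exact Set.inter_subset_left
  let Z := pullback (locusι S) (locusι (insert (X j) S))
  have hZ : Set.range (pullback.fst (locusι S) (locusι (insert (X j) S))) =
      (U : Set _)ᶜ := by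
    rw [Scheme.Pullback.range_fst, range_locusι, hz, Set.preimage_inter, Set.preimage_compl,
      ← range_locusι, Set.preimage_range, Set.univ_inter]
    rfl
  have h := μ.cl_scissor (locusι S ≫ toSpec k n)
    (pullback.fst (locusι S) (locusι (insert (X j) S)))
    inferInstance inferInstance inferInstance inferInstance U (eq_compl_comm.mpr hZ)
  refine h.trans (congrArg₂ _ ?_ ?_)
  · rw [← Category.assoc, clSpec, ← stratumι_toSpec]
    have : QuasiCompact (stratumι S j ≫ toSpec k n) := by
      rw [stratumι_toSpec]; infer_instance
    have : IsSeparated (stratumι S j ≫ toSpec k n) := by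
      rw [stratumι_toSpec]; infer_instance
    have : QuasiCompact ((U.ι ≫ locusι S) ≫ toSpec k n) := inferInstance
    have : IsSeparated ((U.ι ≫ locusι S) ≫ toSpec k n) := inferInstance
    refine μ.cl_eq_of_range_eq _ _ _ ?_
    rw [range_stratumι j hS, Scheme.Hom.comp_base, TopCat.coe_comp, Set.range_comp,
      Scheme.Opens.range_ι, ← range_locusι, Set.inter_comm, ← Set.image_preimage_eq_inter_range]
    rfl
  · rw [pullback.condition_assoc]
    symm
    refine μ.cl_eq_of_surjective (locusι (insert (X j) S) ≫ toSpec k n) (pullback.snd _ _) ?_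
    rw [← Set.range_eq_univ, Scheme.Pullback.range_snd]
    exact Set.eq_univ_of_forall fun x ↦ hle ⟨x, rfl⟩

theorem clLocus_eq_zero {S : Set (MvPolynomial (Fin (n + 1)) k)}
    (hS : ∀ j, X j ∈ S) : μ.clLocus S = 0 := by
  have : IsEmpty (Scheme.IdealSheafData.vanishingIdeal (closedLocus S)).subscheme := by
    refine Set.range_eq_empty_iff.mp ((range_locusι S).trans ?_)
    refine Set.eq_empty_of_forall_notMem fun x hx ↦ x.not_irrelevant_le ?_
    rw [HomogeneousIdeal.irrelevant_le]
    intro d hd p hp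
    have hX : Ideal.span (X '' Set.univ) ≤ x.asHomogeneousIdeal.toIdeal := by
      rw [Ideal.span_le, Set.image_subset_iff]
      exact fun i _ ↦ hx (hS i)
    refine hX (mem_ideal_span_X_image.mpr fun m hm ↦ ?_)
    by_contra! h0
    have hm0 : m = 0 := Finsupp.ext fun i ↦ h0 i trivial
    have := hp (mem_support_iff.mp hm)
    simp only [hm0, map_zero] at this
    exact hd.ne this
  exact μ.cl_of_isEmpty _

end MotivicMeasure

/-- A quotient of a polynomial algebra is identified with `B` by giving mutually inverse maps. -/
def Ideal.quotientAlgEquivOfMvPolynomial {K σ B : Type*} [CommRing K] [CommRing B] [Algebra K B]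
    {I : Ideal (MvPolynomial σ K)} (f : MvPolynomial σ K →ₐ[K] B)
    (g : B →ₐ[K] MvPolynomial σ K ⧸ I) (hf : I ≤ RingHom.ker f)
    (hgf : ∀ i, g (f (X i)) = Ideal.Quotient.mk I (X i))
    (hfg : (Ideal.Quotient.liftₐ I f hf).comp g = .id K B) :
    (MvPolynomial σ K ⧸ I) ≃ₐ[K] B :=
  .ofAlgHom (Ideal.Quotient.liftₐ I f hf) g hfg <| by
    apply Ideal.Quotient.algHom_ext
    apply MvPolynomial.algHom_ext
    intro i
    exact hgf i

namespace ProjSpace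

variable {k : Type u} [Field k] {m : ℕ}

/-- The inclusion `k[x₀, …, x_m] → k[x₀, …, x_{m+2}]` sending `x_i` to `x_{i+2}`. -/
abbrev shiftTwo (k : Type u) [Field k] (m : ℕ) :
    MvPolynomial (Fin (m + 1)) k →ₐ[k] MvPolynomial (Fin (m + 3)) k :=
  rename fun i ↦ i.succ.succ

/-- The equations `x₁ = 0` and `t(x₂, …, x_{m+2}) = 0` for `t ∈ T`; they define the projective cone
over the zero locus of `T`. -/
def coneEqs (T : Set (MvPolynomial (Fin (m + 1)) k)) : Set (MvPolynomial (Fin (m + 3)) k) :=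
  insert (X 1) (shiftTwo k m '' T)

theorem coneEqs_insert (t : MvPolynomial (Fin (m + 1)) k) (T : Set (MvPolynomial (Fin (m + 1)) k)) :
    coneEqs (insert t T) = insert (shiftTwo k m t) (coneEqs T) := by
  rw [coneEqs, coneEqs, Set.image_insert_eq, Set.insert_comm]

theorem coneEqs_homogeneous {T : Set (MvPolynomial (Fin (m + 1)) k)}
    (hT : ∀ t ∈ T, ∃ d, 0 < d ∧ t.IsHomogeneous d) :
    ∀ s ∈ coneEqs T, ∃ d, 0 < d ∧ s.IsHomogeneous d := by
  rintro _ (rfl | ⟨t, ht, rfl⟩)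
  · exact ⟨1, one_pos, isHomogeneous_X k 1⟩
  · obtain ⟨d, hd, h⟩ := hT t ht
    exact ⟨d, hd, h.rename_isHomogeneous⟩

/-- The parametrization `(t, y) ↦ (t, 0, y)` of the affine cone, on functions. -/
def coneParam (T : Set (MvPolynomial (Fin (m + 1)) k)) : MvPolynomial (Fin (m + 3)) k →ₐ[k]
    Polynomial (MvPolynomial (Fin (m + 1)) k ⧸ Ideal.span T) :=
  aeval (Fin.cons Polynomial.X (Fin.cons 0 fun i ↦ Polynomial.C (Ideal.Quotient.mk _ (X i))) :
    Fin (m + 3) → Polynomial (MvPolynomial (Fin (m + 1)) k ⧸ Ideal.span T))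

theorem coneParam_shiftTwo (T : Set (MvPolynomial (Fin (m + 1)) k))
    (t : MvPolynomial (Fin (m + 1)) k) :
    coneParam T (shiftTwo k m t) = Polynomial.C (Ideal.Quotient.mk _ t) := by
  have : (coneParam T).comp (shiftTwo k m) =
      (Polynomial.CAlgHom (R := k)).comp (Ideal.Quotient.mkₐ k (Ideal.span T)) := by
    apply MvPolynomial.algHom_ext
    intro i
    simp [coneParam]
  exact DFunLike.congr_fun this t

/-- The affine cone is a product with a line. -/
def quotientConeEquiv (T : Set (MvPolynomial (Fin (m + 1)) k)) :
    (MvPolynomial (Fin (m + 3)) k ⧸ Ideal.span (coneEqs T)) ≃ₐ[k]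
      Polynomial (MvPolynomial (Fin (m + 1)) k ⧸ Ideal.span T) :=
  have hg (t : MvPolynomial (Fin (m + 1)) k) (ht : t ∈ Ideal.span T) :
      (Ideal.Quotient.mkₐ k (Ideal.span (coneEqs T))).comp (shiftTwo k m) t = 0 := by
    have : Ideal.map (shiftTwo k m) (Ideal.span T) ≤ Ideal.span (coneEqs T) := by
      rw [Ideal.map_span]
      exact Ideal.span_mono (Set.subset_insert _ _)
    exact Ideal.Quotient.eq_zero_iff_mem.mpr (this (Ideal.mem_map_of_mem _ ht))
  Ideal.quotientAlgEquivOfMvPolynomial (I := Ideal.span (coneEqs T))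
    (B := Polynomial (MvPolynomial (Fin (m + 1)) k ⧸ Ideal.span T)) (coneParam T)
    (Polynomial.aevalTower
      (Ideal.Quotient.liftₐ (Ideal.span T)
        ((Ideal.Quotient.mkₐ k (Ideal.span (coneEqs T))).comp (shiftTwo k m)) hg)
      (Ideal.Quotient.mk _ (X 0)))
    (by
      rw [Ideal.span_le]
      rintro _ (rfl | ⟨t, ht, rfl⟩)
      · simp [coneParam, Fin.cons_one]
      · refine (coneParam_shiftTwo T t).trans ?_
        rw [Ideal.Quotient.eq_zero_iff_mem.mpr (Ideal.subset_span ht), map_zero])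
    (by
      intro i
      refine Fin.cases ?_ (fun i ↦ Fin.cases ?_ (fun i ↦ ?_) i) i
      · simp [coneParam]
      · simp [coneParam]
        symm
        exact Ideal.Quotient.eq_zero_iff_mem.mpr (Ideal.subset_span (Set.mem_insert _ _))
      · simp [coneParam]
        exact congrArg (Ideal.Quotient.mk _) (rename_X _ _))
    (by
      apply Polynomial.algHom_ext'
      · apply Ideal.Quotient.algHom_ext
        apply MvPolynomial.algHom_ext
        intro i
        simp
        exact coneParam_shiftTwo T (X i)
      · simp
        exact aeval_X _ _)

/-- The part `x₁ ≠ 0` of the quadric `x₀x₁ + t(x₂, …, x_{m+2})` is an affine space. -/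
def stratumRingQuadricEquiv (t : MvPolynomial (Fin (m + 1)) k) :
    StratumRing {X 0 * X 1 + shiftTwo k m t} 1 ≃ₐ[k] MvPolynomial (Fin (m + 1)) k :=
  have hf : (aeval (Fin.cons (-t) (Fin.cons 1 X) : Fin (m + 3) → MvPolynomial (Fin (m + 1)) k)).comp
      (shiftTwo k m) = .id k _ := by
    apply MvPolynomial.algHom_ext
    intro i
    simp
  Ideal.quotientAlgEquivOfMvPolynomial (aeval (Fin.cons (-t) (Fin.cons 1 X)))
    ((Ideal.Quotient.mkₐ k _).comp (shiftTwo k m))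
    (by
      have := DFunLike.congr_fun hf t
      rw [Ideal.span_le]
      rintro _ (rfl | rfl)
      · simp [Fin.cons_one]
      · refine (map_add _ _ _).trans ?_
        rw [map_mul, aeval_X, aeval_X, Fin.cons_zero, Fin.cons_one, Fin.cons_zero, mul_one]
        exact (congrArg _ this).trans (neg_add_cancel t))
    (by
      have h1 := mk_X_stratumRing {X 0 * X 1 + shiftTwo k m t} 1
      have h2 : Ideal.Quotient.mk (Ideal.span (insert (X 1 - 1) {X 0 * X 1 + shiftTwo k m t}))
          (X 0 * X 1 + shiftTwo k m t) = 0 :=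
        Ideal.Quotient.eq_zero_iff_mem.mpr (Ideal.subset_span (Set.mem_insert_of_mem _ rfl))
      rw [map_add, map_mul, h1, mul_one] at h2
      intro i
      refine Fin.cases ?_ (fun i ↦ Fin.cases ?_ (fun i ↦ ?_) i) i
      · simp
        exact (eq_neg_of_add_eq_zero_left h2).symm
      · simp
        exact h1.symm
      · simp)
    hf

/-- The vertex of a cone. -/
def stratumRingVertexEquiv {T : Set (MvPolynomial (Fin (m + 1)) k)}
    (hT : ∀ t ∈ T, ∃ d, 0 < d ∧ t.IsHomogeneous d) (hX : ∀ i, X i ∈ T) :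
    StratumRing (coneEqs T) 0 ≃ₐ[k] k :=
  Ideal.quotientAlgEquivOfMvPolynomial (aeval (Fin.cons 1 0)) (Algebra.ofId k _)
    (by
      rw [Ideal.span_le]
      rintro _ (rfl | rfl | ⟨t, ht, rfl⟩)
      · simp
      · simp [Fin.cons_one]
      · obtain ⟨d, hd, h⟩ := hT t ht
        have h0 : constantCoeff t = 0 := by
          by_contra h1
          exact hd.ne (by simpa using h h1)
        have : (fun i : Fin (m + 1) ↦ (Fin.cons 1 0 : Fin (m + 3) → k) i.succ.succ) = 0 := by
          ext i
          simp
        simp only [SetLike.mem_coe, RingHom.mem_ker, aeval_rename, Function.comp_def, this]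
        simpa using h0)
    (by
      have hmem {s} (hs : s ∈ coneEqs T) :
          Ideal.Quotient.mk (Ideal.span (insert (X 0 - 1) (coneEqs T))) s = 0 :=
        Ideal.Quotient.eq_zero_iff_mem.mpr (Ideal.subset_span (Set.mem_insert_of_mem _ hs))
      intro i
      refine Fin.cases ?_ (fun i ↦ Fin.cases ?_ (fun i ↦ ?_) i) i
      · simp [mk_X_stratumRing]
      · simp
        exact (hmem (Set.mem_insert _ _)).symm
      · simp
        exact (hmem (Set.mem_insert_of_mem _ ⟨_, hX i, rename_X _ _⟩)).symm)
    (Subsingleton.elim _ _)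

end ProjSpace

namespace MotivicMeasure

open ProjSpace

variable {k : Type u} [Field k] {R : Type v} [CommRing R] (μ : MotivicMeasure k R) {m : ℕ}

theorem clSpec_stratumRing_coneEqs (T : Set (MvPolynomial (Fin (m + 1)) k)) (j : Fin (m + 1)) :
    μ.clSpec (StratumRing (coneEqs T) j.succ.succ) = μ.lef * μ.clSpec (StratumRing T j) := by
  have h : insert (X j.succ.succ - 1) (coneEqs T) = coneEqs (insert (X j - 1) T) := by
    simp [coneEqs_insert]
  rw [← clSpec_polynomial]
  exact μ.clSpec_congr ((Ideal.quotientEquivAlgOfEq k (congrArg _ h)).trans (quotientConeEquiv _))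

/-- The class of a projective cone. -/
theorem clLocus_coneEqs {T : Set (MvPolynomial (Fin (m + 1)) k)}
    (hT : ∀ t ∈ T, ∃ d, 0 < d ∧ t.IsHomogeneous d) :
    μ.clLocus (coneEqs T) = μ.lef * μ.clLocus T + 1 := by
  suffices ∀ (s : Finset (Fin (m + 1))) (T : Set (MvPolynomial (Fin (m + 1)) k)),
      (∀ t ∈ T, ∃ d, 0 < d ∧ t.IsHomogeneous d) → (∀ j ∉ s, X j ∈ T) →
      μ.clLocus (coneEqs T) = μ.lef * μ.clLocus T + 1 from
    this Finset.univ T hT fun j hj ↦ (hj (Finset.mem_univ j)).elim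
  intro s
  induction s using Finset.induction_on with
  | empty =>
    intro T hT hX
    replace hX : ∀ j, X j ∈ T := by simpa using hX
    rw [μ.clLocus_eq_add (coneEqs_homogeneous hT) 0,
      μ.clSpec_congr (stratumRingVertexEquiv hT hX), clSpec_self, μ.clLocus_eq_zero hX,
      μ.clLocus_eq_zero]
    · ring
    · refine Fin.cases (Set.mem_insert _ _) fun i ↦ Set.mem_insert_of_mem _ ?_
      refine Fin.cases (Set.mem_insert _ _) (fun i ↦ ?_) i
      exact Set.mem_insert_of_mem _ ⟨_, hX i, rename_X _ _⟩
  | insert j s _ ih =>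
    intro T hT hX
    have h : insert (X j.succ.succ) (coneEqs T) = coneEqs (insert (X j) T) := by
      simp [coneEqs_insert]
    rw [μ.clLocus_eq_add (coneEqs_homogeneous hT) j.succ.succ, clSpec_stratumRing_coneEqs, h,
      μ.clLocus_eq_add hT j, ih]
    · ring
    · rintro t (rfl | ht)
      exacts [⟨1, one_pos, isHomogeneous_X k j⟩, hT t ht]
    · intro i hi
      by_cases hij : i = j
      · exact hij ▸ Set.mem_insert _ _
      · exact Set.mem_insert_of_mem _ (hX i (by simp [hij, hi]))

theorem clLocus_quadric {t : MvPolynomial (Fin (m + 1)) k} (ht : t.IsHomogeneous 2) :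
    μ.clLocus {X 0 * X 1 + shiftTwo k m t} =
      1 + μ.lef * μ.clLocus {t} + μ.lef ^ (m + 1) := by
  have hq : (X 0 * X 1 + shiftTwo k m t).IsHomogeneous 2 :=
    ((isHomogeneous_X k 0).mul (isHomogeneous_X k 1)).add ht.rename_isHomogeneous
  have hspan : Ideal.span (insert (X 1) {X 0 * X 1 + shiftTwo k m t}) =
      Ideal.span (coneEqs {t}) := by
    rw [coneEqs, Set.image_singleton, Ideal.span_pair_comm, add_comm (X 0 * X 1),
      Ideal.span_pair_add_mul_right, Ideal.span_pair_comm]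
  rw [μ.clLocus_eq_add (j := 1) (by simpa using ⟨2, two_pos, hq⟩),
    μ.clSpec_congr (stratumRingQuadricEquiv t), clSpec_mvPolynomial,
    μ.clLocus_eq_of_span_eq hspan, clLocus_coneEqs _ (by simpa using ⟨2, two_pos, ht⟩)]
  ring

end MotivicMeasure

end

/-- Let `k` be a field of characteristic zero and let
`Q = V(q) ⊂ ℙⁿ_k` (here `n = m + 2`) be a smooth quadric hypersurface with a `k`-rational
point, written after a linear change of coordinates as `q = x₀x₁ + q'(x₂, …, xₙ)` with
`q'` a quadratic form, and let `Y := V(q') ⊂ ℙ^{n-2}_k`.  Then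
`[Q] = 1 + 𝕃·[Y] + 𝕃^{n-1}` in `K₀(Var_k)`. -/
theorem smooth_quadric_class_formula (k : Type u) [Field k] [CharZero k] (m : ℕ)
    (q' : MvPolynomial (Fin (m + 1)) k) (hq' : q'.IsHomogeneous 2)
    (q : MvPolynomial (Fin (m + 3)) k)
    (hq : q = X 0 * X 1
      + rename (fun i : Fin (m + 1) => (⟨i.1 + 2, by omega⟩ : Fin (m + 3))) q')
    (Q : Scheme.{u}) (sQ : Q ⟶ SpecBase k) (hQ : IsProjSubvariety k (m + 2) {q} Q sQ)
    (hsmooth : IsSmooth sQ)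
    (Y : Scheme.{u}) (sY : Y ⟶ SpecBase k) (hY : IsProjSubvariety k m {q'} Y sY) :
    ∀ (R : Type u) [CommRing R] (μ : MotivicMeasure k R),
      μ.cl Q sQ = 1 + μ.lef * μ.cl Y sY + μ.lef ^ (m + 1) := by
  intro R _ μ
  rw [μ.cl_eq_clLocus hQ, μ.cl_eq_clLocus hY, hq]
  exact μ.clLocus_quadric hq'
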